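/- (Additivity of the Gaussian Rényi-2 entanglement of formation.) Let V be a quantum covariance matrix on n_{A1} + n_{B1} modes (bipartite between A1 and B1) and W a quantum covariance matrix on n_{A2} + n_{B2} modes (bipartite between A2 and B2). Let U be the quantum covariance matrix on (n_{A1}+n_{A2}) + (n_{B1}+n_{B2}) modes whose principal submatrix on the A1,B1 coordinates is V, whose principal submatrix on the A2,B2 coordinates is W, and whose remaining off-diagonal blocks vanish. Then, with respect to the bipartition A1A2 versus B1B2, E^G_{F,2}(A1A2 : B1B2)_U = E^G_{F,2}(A1:B1)_V + E^G_{F,2}(A2:B2)_W. -/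

import Mathlib

open Matrix
open scoped ComplexOrder

/-- Log-det mutual information of a bipartite positive definite matrix. -/
noncomputable def IM2 {α β : Type*} [Fintype α] [Fintype β] [DecidableEq α] [DecidableEq β]
    (V : Matrix (α ⊕ β) (α ⊕ β) ℝ) : ℝ :=
  (1 / 2) * Real.log ((V.toBlocks₁₁.det * V.toBlocks₂₂.det) / V.det)

/-- The standard symplectic form on `n` modes. -/
def Omg (n : ℕ) : Matrix (Fin n ⊕ Fin n) (Fin n ⊕ Fin n) ℝ :=
  fromBlocks 0 1 (-1) 0

/-- A real matrix is symplectic (with respect to a given form `Ω`) if `S Ω Sᵀ = Ω`. -/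
def IsSymplectic {N : Type*} [Fintype N] (Ω S : Matrix N N ℝ) : Prop :=
  S * Ω * Sᵀ = Ω

/-- Complexification of a real matrix. -/
noncomputable def cplx {μ ν : Type*} (M : Matrix μ ν ℝ) : Matrix μ ν ℂ :=
  M.map (fun x => (x : ℂ))

/-- A quantum covariance matrix with respect to a symplectic form `Ω`: a real symmetric
matrix `V` with `V + iΩ ≥ 0`. -/
def IsQCM {N : Type*} [Fintype N] [DecidableEq N] (Ω V : Matrix N N ℝ) : Prop :=
  V.IsSymm ∧ (cplx V + Complex.I • cplx Ω).PosSemidef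

/-- A pure quantum covariance matrix: `V = S Sᵀ` with `S` symplectic. -/
def IsPureQCM {N : Type*} [Fintype N] (Ω V : Matrix N N ℝ) : Prop :=
  ∃ S, IsSymplectic Ω S ∧ V = S * Sᵀ

/-- The Gaussian Rényi-2 entanglement of formation of a bipartite QCM `V`, with respect
to the bipartite symplectic form `Ω`. -/
noncomputable def EF2 {α β : Type*} [Fintype α] [Fintype β] [DecidableEq α] [DecidableEq β]
    (Ω V : Matrix (α ⊕ β) (α ⊕ β) ℝ) : ℝ :=
  sInf {x | ∃ γ : Matrix (α ⊕ β) (α ⊕ β) ℝ,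
    IsPureQCM Ω γ ∧ (V - γ).PosSemidef ∧ x = (1 / 2) * IM2 γ}

/-- If `1 ≤ C` in the Löwner order then `1 ≤ det C`. -/
lemma one_le_det_of_sub_one_posSemidef {n : Type*} [Fintype n] [DecidableEq n]
    {C : Matrix n n ℝ} (h : (C - 1).PosSemidef) : 1 ≤ C.det := by
  have hC : C.IsHermitian := by simpa using h.1.add isHermitian_one
  rw [hC.det_eq_prod_eigenvalues]
  refine Finset.one_le_prod fun i _ => ?_
  set v := hC.eigenvectorBasis i
  have h1 := h.dotProduct_mulVec_nonneg v
  have h2 : star (v : n → ℝ) ⬝ᵥ (v : n → ℝ) = 1 := by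
    rw [dotProduct_comm, ← EuclideanSpace.inner_eq_star_dotProduct, inner_self_eq_norm_sq_to_K,
      hC.eigenvectorBasis.orthonormal.1 i]
    simp
  rw [sub_mulVec, hC.mulVec_eigenvectorBasis, one_mulVec, dotProduct_sub, dotProduct_smul, h2] at h1
  simpa using h1

/-- The determinant is monotone in the Löwner order on positive definite matrices. -/
lemma Matrix.PosDef.det_le_det {n : Type*} [Fintype n] [DecidableEq n] {A B : Matrix n n ℝ}
    (hA : A.PosDef) (h : (B - A).PosSemidef) : A.det ≤ B.det := by
  obtain ⟨R, hR, rfl⟩ : ∃ R : Matrix n n ℝ, IsUnit R.det ∧ A = R * Rᴴ := by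
    open scoped MatrixOrder in
    obtain ⟨R, hR⟩ := CStarAlgebra.nonneg_iff_eq_star_mul_self.mp hA.posSemidef.nonneg
    refine ⟨Rᴴ, ?_, by simpa [star_eq_conjTranspose] using hR⟩
    have := hA.det_pos
    rw [hR, det_mul] at this
    simpa [det_conjTranspose] using right_ne_zero_of_mul this.ne'
  have hR' : IsUnit (Rᴴ).det := by simpa [det_conjTranspose] using hR
  have h1 := one_le_det_of_sub_one_posSemidef (C := R⁻¹ * B * (R⁻¹)ᴴ) (by
    have := h.mul_mul_conjTranspose_same R⁻¹
    rwa [Matrix.mul_sub, Matrix.sub_mul, ← Matrix.mul_assoc R⁻¹ R, nonsing_inv_mul _ hR,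
      Matrix.one_mul, conjTranspose_nonsing_inv, mul_nonsing_inv _ hR',
      ← conjTranspose_nonsing_inv] at this)
  have hpos : 0 < (R * Rᴴ).det := hA.det_pos
  have h2 : (R * Rᴴ).det * (R⁻¹ * B * (R⁻¹)ᴴ).det = B.det := by
    simp only [conjTranspose_nonsing_inv, det_mul, det_nonsing_inv]
    have e1 := Ring.mul_inverse_cancel _ hR
    have e2 := Ring.mul_inverse_cancel _ hR'
    calc _ = (R.det * Ring.inverse R.det) * ((Rᴴ).det * Ring.inverse (Rᴴ).det) * B.det := by ring
      _ = _ := by rw [e1, e2]; ring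
  rw [← h2]
  exact le_mul_of_one_le_right hpos.le h1

/-- The Schur complement of a block in a positive definite matrix is positive definite. -/
lemma Matrix.PosDef.schur_complement {m n : Type*} [Fintype m] [Fintype n] [DecidableEq m]
    [DecidableEq n] {A : Matrix m m ℝ} {B : Matrix m n ℝ} {D : Matrix n n ℝ}
    (h : (fromBlocks A B Bᴴ D).PosDef) :
    A.PosDef ∧ (D - Bᴴ * A⁻¹ * B).PosDef ∧
      (fromBlocks A B Bᴴ D).det = A.det * (D - Bᴴ * A⁻¹ * B).det := by
  have hA : A.PosDef := h.submatrix Sum.inl_injective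
  have := hA.isUnit.invertible
  have hdet := det_fromBlocks₁₁ A B Bᴴ D
  rw [invOf_eq_nonsing_inv] at hdet
  have hs := (PosDef.fromBlocks₁₁ B D hA).1 h.posSemidef
  refine ⟨hA, hs.posDef_iff_det_ne_zero.2 fun h0 => ?_, hdet⟩
  rw [h0, mul_zero] at hdet
  exact h.det_pos.ne' hdet

lemma Matrix.PosDef.exists_fromBlocks {m n : Type*} {M : Matrix (m ⊕ n) (m ⊕ n) ℝ}
    (h : M.PosDef) : ∃ A B D, M = fromBlocks A B Bᴴ D := by
  refine ⟨M.toBlocks₁₁, M.toBlocks₁₂, M.toBlocks₂₂, ?_⟩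
  have : M.toBlocks₁₂ᴴ = M.toBlocks₂₁ := by
    ext i j
    exact h.1.apply _ _
  rw [this, fromBlocks_toBlocks]

/-- **Fischer's inequality**. -/
lemma Matrix.PosDef.fischer {m n : Type*} [Fintype m] [Fintype n] [DecidableEq m]
    [DecidableEq n] {M : Matrix (m ⊕ n) (m ⊕ n) ℝ} (h : M.PosDef) :
    M.det ≤ M.toBlocks₁₁.det * M.toBlocks₂₂.det := by
  obtain ⟨A, B, D, rfl⟩ := h.exists_fromBlocks
  obtain ⟨hA, hS, hdet⟩ := h.schur_complement
  rw [hdet, toBlocks_fromBlocks₁₁, toBlocks_fromBlocks₂₂]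
  refine mul_le_mul_of_nonneg_left (hS.det_le_det ?_) hA.det_pos.le
  rw [sub_sub_cancel]
  exact hA.posSemidef.inv.conjTranspose_mul_mul_same B

lemma Matrix.PosDef.det_submatrix_map_id {x y w : Type*} [Fintype x] [Fintype y] [Fintype w]
    [DecidableEq x] [DecidableEq y] [DecidableEq w] {f : w → y} (hf : Function.Injective f)
    {A : Matrix x x ℝ} {B : Matrix x y ℝ} {D : Matrix y y ℝ} (h : (fromBlocks A B Bᴴ D).PosDef) :
    ((fromBlocks A B Bᴴ D).submatrix (Sum.map id f) (Sum.map id f)).det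
      = A.det * ((D - Bᴴ * A⁻¹ * B).submatrix f f).det := by
  have e : (fromBlocks A B Bᴴ D).submatrix (Sum.map id f) (Sum.map id f)
      = fromBlocks A (B.submatrix id f) (B.submatrix id f)ᴴ (D.submatrix f f) := by
    ext (i | i) (j | j) <;> rfl
  have h' := h.submatrix (e := Sum.map id f) (Sum.map_injective.2 ⟨Function.injective_id, hf⟩)
  rw [e] at h' ⊢
  rw [h'.schur_complement.2.2]
  rfl

/-- Strong subadditivity of the log-determinant. -/
lemma Matrix.PosDef.det_strong_subadditivity {x y z : Type*} [Fintype x] [Fintype y] [Fintype z]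
    [DecidableEq x] [DecidableEq y] [DecidableEq z]
    {M : Matrix (x ⊕ (y ⊕ z)) (x ⊕ (y ⊕ z)) ℝ} (h : M.PosDef) :
    M.det * M.toBlocks₁₁.det ≤ (M.submatrix (Sum.map id Sum.inl) (Sum.map id Sum.inl)).det *
      (M.submatrix (Sum.map id Sum.inr) (Sum.map id Sum.inr)).det := by
  obtain ⟨A, B, D, rfl⟩ := h.exists_fromBlocks
  obtain ⟨hA, hS, hdet⟩ := h.schur_complement
  rw [h.det_submatrix_map_id Sum.inl_injective, h.det_submatrix_map_id Sum.inr_injective, hdet,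
    toBlocks_fromBlocks₁₁]
  have := mul_le_mul_of_nonneg_left hS.fischer (mul_pos hA.det_pos hA.det_pos).le
  refine le_trans (le_of_eq (by ring)) (this.trans (le_of_eq ?_))
  change _ * _ * (_ * _) = _ * det (toBlocks₁₁ _) * (_ * det (toBlocks₂₂ _))
  ring

/-- If `[P T; T Q]` is positive semidefinite then `(det T)² ≤ det P det Q`. -/
lemma det_sq_le_of_fromBlocks_posSemidef {n : Type*} [Fintype n] [DecidableEq n]
    {P T Q : Matrix n n ℝ} (hP : P.PosDef) (hT : T.PosDef)
    (h : (fromBlocks P T T Q).PosSemidef) : T.det ^ 2 ≤ P.det * Q.det := by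
  have := hP.isUnit.invertible
  have hTT : Tᴴ = T := hT.1
  have h' : (fromBlocks P T Tᴴ Q).PosSemidef := by rwa [hTT]
  have hs := (PosDef.fromBlocks₁₁ T Q hP).1 h'
  have hpd : (Tᴴ * P⁻¹ * T).PosDef :=
    hP.inv.conjTranspose_mul_mul_same (mulVec_injective_of_isUnit hT.isUnit)
  have := hpd.det_le_det hs
  rw [hTT, det_mul, det_mul, det_nonsing_inv, Ring.inverse_eq_inv'] at this
  have hp := hP.det_pos
  calc T.det ^ 2 = P.det * (T.det * P.det⁻¹ * T.det) := by field_simp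
    _ ≤ _ := mul_le_mul_of_nonneg_left this hp.le

/-- Jacobi's complementary minor formula for principal blocks. -/
lemma det_inv_toBlocks₁₁_mul_det {m n : Type*} [Fintype m] [Fintype n] [DecidableEq m]
    [DecidableEq n] {M : Matrix (m ⊕ n) (m ⊕ n) ℝ} (h : IsUnit M.det) :
    M⁻¹.toBlocks₁₁.det * M.det = M.toBlocks₂₂.det := by
  have hmul : M * M⁻¹ = 1 := mul_nonsing_inv _ h
  have e : M * fromBlocks M⁻¹.toBlocks₁₁ 0 M⁻¹.toBlocks₂₁ 1
      = fromBlocks 1 M.toBlocks₁₂ 0 M.toBlocks₂₂ := by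
    generalize M⁻¹ = N at hmul ⊢
    rw [← fromBlocks_toBlocks M, ← fromBlocks_toBlocks N, fromBlocks_multiply,
      ← fromBlocks_one, fromBlocks_inj] at hmul
    nth_rw 1 [← fromBlocks_toBlocks M]
    rw [fromBlocks_multiply, hmul.1, hmul.2.2.1]
    simp
  have := congrArg det e
  rw [det_mul, det_fromBlocks_zero₁₂, det_fromBlocks_zero₂₁] at this
  simp only [det_one, mul_one, one_mul] at this
  rw [← this, mul_comm]

/-- A (nondegenerate) symplectic form which is also orthogonal. -/
def IsSympForm {N : Type*} [Fintype N] [DecidableEq N] (Ω : Matrix N N ℝ) : Prop :=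
  Ωᵀ = -Ω ∧ Ω * Ω = -1

lemma isSympForm_Omg (n : ℕ) : IsSympForm (Omg n) := by
  constructor
  · simp [Omg, fromBlocks_transpose, fromBlocks_neg]
  · simp [Omg, fromBlocks_multiply, ← fromBlocks_one, fromBlocks_neg]

lemma IsSympForm.fromBlocks {m n : Type*} [Fintype m] [Fintype n] [DecidableEq m]
    [DecidableEq n] {Ω₁ : Matrix m m ℝ} {Ω₂ : Matrix n n ℝ} (h₁ : IsSympForm Ω₁)
    (h₂ : IsSympForm Ω₂) : IsSympForm (fromBlocks Ω₁ 0 0 Ω₂) := by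
  constructor
  · simp [fromBlocks_transpose, fromBlocks_neg, h₁.1, h₂.1]
  · simp [fromBlocks_multiply, ← fromBlocks_one, fromBlocks_neg, h₁.2, h₂.2]

lemma IsSympForm.submatrix {m n : Type*} [Fintype m] [Fintype n] [DecidableEq m]
    [DecidableEq n] {Ω : Matrix n n ℝ} (h : IsSympForm Ω) (e : m ≃ n) :
    IsSympForm (Ω.submatrix e e) := by
  constructor
  · rw [transpose_submatrix, h.1]; rfl
  · rw [submatrix_mul_equiv, h.2]; simp [submatrix_neg]

/-- Real form of the uncertainty relation `σ + iΩ ≥ 0`. -/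
def RealUncertainty {N : Type*} (Ω σ : Matrix N N ℝ) : Prop :=
  (fromBlocks σ Ω Ωᵀ σ).PosSemidef

lemma RealUncertainty.submatrix {M N : Type*} {Ω σ : Matrix N N ℝ} (h : RealUncertainty Ω σ)
    (f : M → N) : RealUncertainty (Ω.submatrix f f) (σ.submatrix f f) := by
  have := PosSemidef.submatrix h (Sum.map f f)
  unfold RealUncertainty
  convert this using 1
  ext (i | i) (j | j) <;> rfl

section SympForm

variable {N : Type*} [Fintype N] [DecidableEq N] {Ω : Matrix N N ℝ}

lemma IsSympForm.isUnit_det (h : IsSympForm Ω) : IsUnit Ω.det := by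
  refine (isUnit_det_of_left_inverse (B := -Ω) ?_)
  rw [Matrix.neg_mul, h.2, neg_neg]

lemma IsPureQCM.det_eq_one {γ : Matrix N N ℝ} (hΩ : IsSympForm Ω) (h : IsPureQCM Ω γ) :
    γ.det = 1 := by
  obtain ⟨S, hS, rfl⟩ := h
  have := congrArg det hS
  rw [det_mul, det_mul] at this
  rw [det_mul]
  exact mul_right_cancel₀ hΩ.isUnit_det.ne_zero (by linear_combination this)

lemma IsPureQCM.posDef {γ : Matrix N N ℝ} (hΩ : IsSympForm Ω) (h : IsPureQCM Ω γ) :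
    γ.PosDef := by
  have h1 := h.det_eq_one hΩ
  obtain ⟨S, hS, rfl⟩ := h
  have : (S * Sᵀ).PosSemidef := by
    simpa using posSemidef_self_mul_conjTranspose S
  exact this.posDef_iff_det_ne_zero.2 (by rw [h1]; exact one_ne_zero)

lemma IsPureQCM.mul_form_mul {γ : Matrix N N ℝ} (hΩ : IsSympForm Ω) (h : IsPureQCM Ω γ) :
    γ * Ω * γ = Ω := by
  obtain ⟨S, hS, rfl⟩ := h
  unfold IsSymplectic at hS
  have h1 : S * (-(Ω * Sᵀ * Ω)) = 1 := by
    rw [Matrix.mul_neg, ← Matrix.mul_assoc, ← Matrix.mul_assoc, hS, hΩ.2, neg_neg]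
  have h2 := mul_eq_one_comm.1 h1
  have h3 : Sᵀ * Ω * S = Ω := by
    calc Sᵀ * Ω * S = -(Ω * Ω) * (Sᵀ * Ω * S) := by rw [hΩ.2]; simp
      _ = Ω * (-(Ω * Sᵀ * Ω) * S) := by noncomm_ring
      _ = Ω := by rw [h2, Matrix.mul_one]
  calc S * Sᵀ * Ω * (S * Sᵀ) = S * (Sᵀ * Ω * S) * Sᵀ := by simp only [Matrix.mul_assoc]
    _ = Ω := by rw [h3, hS]

lemma IsPureQCM.inv_eq {γ : Matrix N N ℝ} (hΩ : IsSympForm Ω) (h : IsPureQCM Ω γ) :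
    -(Ω * γ⁻¹ * Ω) = γ := by
  have hu : IsUnit γ.det := by rw [h.det_eq_one hΩ]; exact isUnit_one
  have h1 : γ⁻¹ = -(Ω * γ * Ω) := by
    refine inv_eq_left_inv ?_
    calc -(Ω * γ * Ω) * γ = -(Ω * (γ * Ω * γ)) := by noncomm_ring
      _ = 1 := by rw [h.mul_form_mul hΩ, hΩ.2, neg_neg]
  calc -(Ω * γ⁻¹ * Ω) = (Ω * Ω) * γ * (Ω * Ω) := by rw [h1]; noncomm_ring
    _ = γ := by rw [hΩ.2]; simp

lemma IsPureQCM.realUncertainty {γ : Matrix N N ℝ} (hΩ : IsSympForm Ω) (h : IsPureQCM Ω γ) :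
    RealUncertainty Ω γ := by
  obtain ⟨S, hS, rfl⟩ := h
  unfold IsSymplectic at hS
  have hS' : S * Ωᵀ * Sᵀ = Ωᵀ := by rw [hΩ.1, Matrix.mul_neg, Matrix.neg_mul, hS]
  have hΩΩ : Ω * Ωᵀ = 1 := by rw [hΩ.1, Matrix.mul_neg, hΩ.2, neg_neg]
  have h1 := posSemidef_self_mul_conjTranspose (fromBlocks (S * Ω) 0 S 0 : Matrix (N ⊕ N) (N ⊕ N) ℝ)
  unfold RealUncertainty
  convert h1 using 1
  rw [conjTranspose_eq_transpose_of_trivial, fromBlocks_transpose, fromBlocks_multiply]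
  simp only [transpose_mul, transpose_zero, Matrix.zero_mul, add_zero, ← Matrix.mul_assoc, hS, hS']
  rw [Matrix.mul_assoc S Ω, hΩΩ, Matrix.mul_one]

lemma IsQCM.realUncertainty {σ : Matrix N N ℝ} (h : IsQCM Ω σ) : RealUncertainty Ω σ := by
  have hpos := h.2
  obtain ⟨B, hB⟩ : ∃ B : Matrix N N ℂ, cplx σ + Complex.I • cplx Ω = Bᴴ * B := by
    open scoped MatrixOrder in
    exact CStarAlgebra.nonneg_iff_eq_star_mul_self.mp hpos.nonneg
  have hre : ∀ i j, σ i j = ∑ k, ((B k i).re * (B k j).re + (B k i).im * (B k j).im) := by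
    intro i j
    have := congrArg Complex.re (congrFun (congrFun hB i) j)
    simpa [cplx, mul_apply] using this
  have him : ∀ i j, Ω i j = ∑ k, ((B k i).re * (B k j).im - (B k i).im * (B k j).re) := by
    intro i j
    have := congrArg Complex.im (congrFun (congrFun hB i) j)
    simpa [cplx, mul_apply, sub_eq_add_neg] using this
  have h1 := posSemidef_conjTranspose_mul_self
    (fromBlocks (B.map Complex.re) (B.map Complex.im) (-B.map Complex.im) (B.map Complex.re))
  unfold RealUncertainty
  convert h1 using 1
  rw [conjTranspose_eq_transpose_of_trivial, fromBlocks_transpose, fromBlocks_multiply,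
    fromBlocks_inj]
  refine ⟨?_, ?_, ?_, ?_⟩ <;> ext i j <;>
    simp only [hre, him, transpose_apply, Matrix.add_apply, mul_apply, Matrix.neg_apply, map_apply,
      ← Finset.sum_add_distrib] <;>
    exact Finset.sum_congr rfl fun k _ => by ring

lemma RealUncertainty.posDef {σ : Matrix N N ℝ} (hΩ : IsSympForm Ω) (h : RealUncertainty Ω σ) :
    σ.PosDef := by
  have hσ : σ.PosSemidef := PosSemidef.submatrix h Sum.inl
  refine hσ.posDef_iff_det_ne_zero.2 fun h0 => ?_
  obtain ⟨v, hv, hσv⟩ := exists_mulVec_eq_zero_iff.2 h0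
  have h1 : fromBlocks σ Ω Ωᵀ σ *ᵥ Sum.elim v 0 = 0 := by
    refine (PosSemidef.dotProduct_mulVec_zero_iff h _).1 ?_
    simp [fromBlocks_mulVec, hσv, dotProduct]
  have h2 : Ωᵀ *ᵥ v = 0 := by
    ext i
    simpa [fromBlocks_mulVec] using congrFun h1 (Sum.inr i)
  exact hv (eq_zero_of_mulVec_eq_zero (by simpa using hΩ.isUnit_det.ne_zero) h2)

lemma RealUncertainty.add_form_mul_inv_mul_form {σ : Matrix N N ℝ} (hΩ : IsSympForm Ω)
    (h : RealUncertainty Ω σ) : (σ + Ω * σ⁻¹ * Ω).PosSemidef := by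
  have hσ := h.posDef hΩ
  have := hσ.isUnit.invertible
  have h1 := (PosDef.fromBlocks₁₁ Ω σ hσ).1 (by simpa [RealUncertainty] using h)
  simpa [hΩ.1] using h1

open scoped MatrixOrder in
lemma Matrix.PosSemidef.exists_sqrt {A : Matrix N N ℝ} (hA : A.PosSemidef) :
    ∃ R : Matrix N N ℝ, R.PosSemidef ∧ R * R = A ∧ ∀ B, Commute A B → Commute R B :=
  ⟨CFC.sqrt A, (CFC.sqrt_nonneg A).posSemidef, CFC.sqrt_mul_sqrt_self A hA.nonneg,
    fun _ h => Commute.cfcₙ_nnreal h _⟩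

open scoped MatrixOrder in
lemma Matrix.PosSemidef.eq_of_mul_self_eq {A B : Matrix N N ℝ} (hA : A.PosSemidef)
    (hB : B.PosSemidef) (h : A * A = B * B) : A = B :=
  (CFC.sqrt_unique h hA.nonneg).symm.trans (CFC.sqrt_unique rfl hB.nonneg)

/-- A positive definite `τ` with `τ Ω τ = Ω` is a pure quantum covariance matrix. -/
lemma isPureQCM_of_mul_form_mul {τ : Matrix N N ℝ} (hΩ : IsSympForm Ω) (hτ : τ.PosSemidef)
    (h : τ * Ω * τ = Ω) : IsPureQCM Ω τ := by
  obtain ⟨S, hS, hSS, -⟩ := hτ.exists_sqrt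
  have hST : Sᵀ = S := by simpa using hS.1.eq
  have hinv : τ * (-(Ω * τ * Ω)) = 1 := by
    rw [Matrix.mul_neg, ← Matrix.mul_assoc, ← Matrix.mul_assoc, h, hΩ.2, neg_neg]
  have hSu : IsUnit S.det := by
    refine isUnit_det_of_right_inverse (B := S * (-(Ω * τ * Ω))) ?_
    rw [← Matrix.mul_assoc, hSS, hinv]
  have hY : (-(Ω * S * Ω)).PosSemidef := by
    have := hS.conjTranspose_mul_mul_same Ω
    simpa [hΩ.1] using this
  have hYS : -(Ω * S * Ω) = S⁻¹ := by
    refine hY.eq_of_mul_self_eq hS.inv ?_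
    rw [← Matrix.mul_inv_rev, hSS, inv_eq_right_inv hinv, ← hSS]
    calc -(Ω * S * Ω) * -(Ω * S * Ω) = Ω * S * (Ω * Ω) * S * Ω := by noncomm_ring
      _ = _ := by rw [hΩ.2]; noncomm_ring
  have h1 : S * (-(Ω * S * Ω)) = 1 := by rw [hYS, mul_nonsing_inv _ hSu]
  refine ⟨S, ?_, by rw [hST, hSS]⟩
  unfold IsSymplectic
  rw [hST]
  calc S * Ω * S = -(S * Ω * S * (Ω * Ω)) := by rw [hΩ.2]; simp
    _ = S * (-(Ω * S * Ω)) * Ω := by noncomm_ring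
    _ = Ω := by rw [h1, Matrix.one_mul]

/-- Below every quantum covariance matrix `σ` there is a pure one, namely the geometric mean of `σ`
and `Ω σ⁻¹ Ωᵀ`. -/
lemma RealUncertainty.exists_pure_le {σ : Matrix N N ℝ} (hΩ : IsSympForm Ω)
    (h : RealUncertainty Ω σ) :
    ∃ τ, IsPureQCM Ω τ ∧ (σ - τ).PosSemidef ∧
      (fromBlocks σ τ τ (-(Ω * σ⁻¹ * Ω))).PosSemidef := by
  have hσ := h.posDef hΩ
  have hΩσ := h.add_form_mul_inv_mul_form hΩ
  obtain ⟨R, hR, rfl, -⟩ := hσ.posSemidef.exists_sqrt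
  have hRu : IsUnit R.det := by
    have := hσ.det_pos.ne'
    rw [det_mul] at this
    exact (left_ne_zero_of_mul this).isUnit
  have hRT : Rᵀ = R := by simpa using hR.1.eq
  have hRR : R * R⁻¹ = 1 := mul_nonsing_inv _ hRu
  have hRR' : R⁻¹ * R = 1 := nonsing_inv_mul _ hRu
  have hPT : (R⁻¹)ᵀ = R⁻¹ := by rw [transpose_nonsing_inv, hRT]
  rw [Matrix.mul_inv_rev] at hΩσ ⊢
  generalize R⁻¹ = P at *
  obtain ⟨L, hL⟩ : ∃ L, L = P * Ω * P := ⟨_, rfl⟩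
  have hLT : Lᵀ = -L := by
    rw [hL, transpose_mul, transpose_mul, hPT, hΩ.1]; noncomm_ring
  have hLL : (-(L * L)).PosSemidef := by
    have := posSemidef_self_mul_conjTranspose L
    simpa [hLT] using this
  obtain ⟨X, hX, hXX, hXL⟩ := hLL.exists_sqrt
  have hXT : Xᵀ = X := by simpa using hX.1.eq
  have hcomm : X * L = L * X := hXL L (by
    simp only [Commute, SemiconjBy]; noncomm_ring)
  have h1X : (1 - X * X).PosSemidef := by
    have := hΩσ.mul_mul_conjTranspose_same P
    rw [conjTranspose_eq_transpose_of_trivial, hPT] at this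
    convert this using 1
    calc 1 - X * X = 1 + L * L := by rw [hXX]; noncomm_ring
      _ = (P * R) * (R * P) + (P * Ω * P) * (P * Ω * P) := by rw [hRR, hRR', hL]; simp
      _ = _ := by noncomm_ring
  have h1X' : (1 - X).PosSemidef := by
    have h2 : ((1 - X) * (1 - X)).PosSemidef := by
      have := posSemidef_self_mul_conjTranspose (1 - X)
      simpa [hXT] using this
    have h3 := (h2.add h1X).smul (show (0 : ℝ) ≤ 1 / 2 by norm_num)
    convert h3 using 1
    have : (1 - X) * (1 - X) + (1 - X * X) = (2 : ℝ) • (1 - X) := by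
      rw [two_smul]; noncomm_ring
    rw [this, smul_smul]
    norm_num
  have hRXR : R * Ω * R * L = -1 := by
    calc R * Ω * R * L = R * Ω * (R * P) * Ω * P := by rw [hL]; noncomm_ring
      _ = R * (Ω * Ω) * P := by rw [hRR]; noncomm_ring
      _ = -(R * P) := by rw [hΩ.2]; noncomm_ring
      _ = -1 := by rw [hRR]
  have hRXR' : L * (R * Ω * R) = -1 := by
    calc L * (R * Ω * R) = P * Ω * (P * R) * Ω * R := by rw [hL]; noncomm_ring
      _ = P * (Ω * Ω) * R := by rw [hRR']; noncomm_ring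
      _ = -(P * R) := by rw [hΩ.2]; noncomm_ring
      _ = -1 := by rw [hRR']
  have hRLR : R * L * R = Ω := by
    calc R * L * R = (R * P) * Ω * (P * R) := by rw [hL]; noncomm_ring
      _ = Ω := by rw [hRR, hRR']; simp
  have hτpos : (R * X * R).PosSemidef := by
    simpa [hRT] using hX.mul_mul_conjTranspose_same R
  refine ⟨R * X * R, isPureQCM_of_mul_form_mul hΩ hτpos ?_, ?_, ?_⟩
  · obtain ⟨K, hK⟩ : ∃ K, K = R * Ω * R := ⟨_, rfl⟩
    rw [← hK] at hRXR hRXR'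
    have hXK : X * K = K * X := by
      calc X * K = -(-1 * X * K) := by noncomm_ring
        _ = -(K * (L * X) * K) := by rw [← hRXR]; noncomm_ring
        _ = -(K * X * (L * K)) := by rw [← hcomm]; noncomm_ring
        _ = K * X := by rw [hRXR']; noncomm_ring
    calc R * X * R * Ω * (R * X * R) = R * (X * K * X) * R := by rw [hK]; noncomm_ring
      _ = R * (K * (X * X)) * R := by rw [hXK]; noncomm_ring
      _ = R * (-(K * L) * L) * R := by rw [hXX]; noncomm_ring
      _ = R * L * R := by rw [hRXR]; simp
      _ = Ω := hRLR
  · have := h1X'.mul_mul_conjTranspose_same R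
    rw [conjTranspose_eq_transpose_of_trivial, hRT] at this
    convert this using 1
    noncomm_ring
  · have := posSemidef_self_mul_conjTranspose
      (fromBlocks R 0 (R * X) 0 : Matrix (N ⊕ N) (N ⊕ N) ℝ)
    convert this using 1
    rw [conjTranspose_eq_transpose_of_trivial, fromBlocks_transpose, fromBlocks_multiply,
      fromBlocks_inj]
    simp only [transpose_mul, hRT, hXT, transpose_zero, Matrix.zero_mul, add_zero,
      Matrix.mul_assoc, true_and]
    calc -(Ω * (P * (P * Ω))) = -((R * L * R) * P * P * (R * L * R)) := by
          rw [hRLR]; noncomm_ring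
      _ = -(R * L * (R * P) * (P * R) * L * R) := by noncomm_ring
      _ = R * -(L * L) * R := by rw [hRR, hRR']; noncomm_ring
      _ = _ := by rw [← hXX]; noncomm_ring

end SympForm

section Complement

variable {x y N : Type*} [Fintype x] [Fintype y] [Fintype N] [DecidableEq x] [DecidableEq y]
  [DecidableEq N] {Ω : Matrix N N ℝ} {Ωx : Matrix x x ℝ} {Ωy : Matrix y y ℝ}

lemma det_form_conj_submatrix (hΩ : IsSympForm Ω) (e : x ⊕ y ≃ N)
    (he : Ω.submatrix e e = fromBlocks Ωx 0 0 Ωy) (M : Matrix N N ℝ) :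
    ((-(Ω * M * Ω)).submatrix (e ∘ Sum.inl) (e ∘ Sum.inl)).det
      = (M.submatrix (e ∘ Sum.inl) (e ∘ Sum.inl)).det := by
  have hΩ' := hΩ.submatrix e
  rw [he] at hΩ'
  obtain ⟨h1, h2⟩ := hΩ'
  rw [fromBlocks_transpose, fromBlocks_neg, fromBlocks_inj] at h1
  rw [fromBlocks_multiply, ← fromBlocks_one, fromBlocks_neg, fromBlocks_inj] at h2
  have h3 : Ωxᵀ * Ωx = 1 := by
    have := h2.1
    rw [h1.1, Matrix.neg_mul]
    simp at this
    rw [this, neg_neg]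
  have e1 : (-(Ω * M * Ω)).submatrix e e
      = -(fromBlocks Ωx 0 0 Ωy * M.submatrix e e * fromBlocks Ωx 0 0 Ωy) := by
    rw [← he, submatrix_mul_equiv, submatrix_mul_equiv]; rfl
  have e2 : (-(Ω * M * Ω)).submatrix (e ∘ Sum.inl) (e ∘ Sum.inl)
      = Ωxᵀ * M.submatrix (e ∘ Sum.inl) (e ∘ Sum.inl) * Ωx := by
    change ((-(Ω * M * Ω)).submatrix e e).toBlocks₁₁ = Ωxᵀ * (M.submatrix e e).toBlocks₁₁ * Ωx
    rw [e1, ← fromBlocks_toBlocks (M.submatrix e e), fromBlocks_multiply, fromBlocks_multiply,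
      fromBlocks_neg]
    simp [h1.1]
  rw [e2, det_mul, det_mul, mul_right_comm, ← det_mul, h3, det_one, one_mul]

lemma det_form_inv_submatrix_mul_det (hΩ : IsSympForm Ω) (e : x ⊕ y ≃ N)
    (he : Ω.submatrix e e = fromBlocks Ωx 0 0 Ωy) {M : Matrix N N ℝ} (hM : M.PosDef) :
    ((-(Ω * M⁻¹ * Ω)).submatrix (e ∘ Sum.inl) (e ∘ Sum.inl)).det * M.det
      = (M.submatrix (e ∘ Sum.inr) (e ∘ Sum.inr)).det := by
  rw [det_form_conj_submatrix hΩ e he]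
  have h1 : IsUnit (M.submatrix e e).det := by
    rw [det_submatrix_equiv_self]; exact hM.det_pos.ne'.isUnit
  have h2 := det_inv_toBlocks₁₁_mul_det h1
  rwa [det_submatrix_equiv_self, inv_submatrix_equiv] at h2

/-- Complementary principal minors of a pure quantum covariance matrix coincide. -/
lemma IsPureQCM.det_submatrix_eq {γ : Matrix N N ℝ} (hΩ : IsSympForm Ω) (h : IsPureQCM Ω γ)
    (e : x ⊕ y ≃ N) (he : Ω.submatrix e e = fromBlocks Ωx 0 0 Ωy) :
    (γ.submatrix (e ∘ Sum.inl) (e ∘ Sum.inl)).det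
      = (γ.submatrix (e ∘ Sum.inr) (e ∘ Sum.inr)).det := by
  rw [← det_form_inv_submatrix_mul_det hΩ e he (h.posDef hΩ), h.inv_eq hΩ, h.det_eq_one hΩ,
    mul_one]

lemma det_submatrix_sq_mul_det_le {σ τ : Matrix N N ℝ} (hΩ : IsSympForm Ω) (hσ : σ.PosDef)
    (hτ : τ.PosDef) (h : (fromBlocks σ τ τ (-(Ω * σ⁻¹ * Ω))).PosSemidef)
    (e : x ⊕ y ≃ N) (he : Ω.submatrix e e = fromBlocks Ωx 0 0 Ωy) :
    (τ.submatrix (e ∘ Sum.inl) (e ∘ Sum.inl)).det ^ 2 * σ.det ≤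
      (σ.submatrix (e ∘ Sum.inl) (e ∘ Sum.inl)).det *
        (σ.submatrix (e ∘ Sum.inr) (e ∘ Sum.inr)).det := by
  have hinj : Function.Injective (e ∘ Sum.inl) := e.injective.comp Sum.inl_injective
  have h1 := h.submatrix (Sum.map (e ∘ Sum.inl) (e ∘ Sum.inl))
  have e1 : (fromBlocks σ τ τ (-(Ω * σ⁻¹ * Ω))).submatrix
      (Sum.map (e ∘ Sum.inl) (e ∘ Sum.inl)) (Sum.map (e ∘ Sum.inl) (e ∘ Sum.inl))
      = fromBlocks (σ.submatrix (e ∘ Sum.inl) (e ∘ Sum.inl))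
        (τ.submatrix (e ∘ Sum.inl) (e ∘ Sum.inl)) (τ.submatrix (e ∘ Sum.inl) (e ∘ Sum.inl))
        ((-(Ω * σ⁻¹ * Ω)).submatrix (e ∘ Sum.inl) (e ∘ Sum.inl)) := by
    ext (i | i) (j | j) <;> rfl
  rw [e1] at h1
  have h2 := det_sq_le_of_fromBlocks_posSemidef (hσ.submatrix hinj) (hτ.submatrix hinj) h1
  rw [← det_form_inv_submatrix_mul_det hΩ e he hσ, ← mul_assoc]
  exact mul_le_mul_of_nonneg_right h2 hσ.det_pos.le

end Complement

lemma IsPureQCM.submatrix {m n : Type*} [Fintype m] [Fintype n] {Ω γ : Matrix n n ℝ}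
    (h : IsPureQCM Ω γ) (e : m ≃ n) : IsPureQCM (Ω.submatrix e e) (γ.submatrix e e) := by
  obtain ⟨S, hS, rfl⟩ := h
  refine ⟨S.submatrix e e, ?_, ?_⟩
  · unfold IsSymplectic at hS ⊢
    rw [transpose_submatrix, submatrix_mul_equiv, submatrix_mul_equiv, hS]
  · rw [transpose_submatrix, submatrix_mul_equiv]

lemma IsPureQCM.fromBlocks {m n : Type*} [Fintype m] [Fintype n] {Ω₁ γ₁ : Matrix m m ℝ}
    {Ω₂ γ₂ : Matrix n n ℝ} (h₁ : IsPureQCM Ω₁ γ₁) (h₂ : IsPureQCM Ω₂ γ₂) :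
    IsPureQCM (Matrix.fromBlocks Ω₁ 0 0 Ω₂) (Matrix.fromBlocks γ₁ 0 0 γ₂) := by
  obtain ⟨S, hS, rfl⟩ := h₁
  obtain ⟨T, hT, rfl⟩ := h₂
  unfold IsSymplectic at hS hT
  refine ⟨Matrix.fromBlocks S 0 0 T, ?_, ?_⟩
  · simp [IsSymplectic, fromBlocks_transpose, fromBlocks_multiply, hS, hT]
  · simp [fromBlocks_transpose, fromBlocks_multiply]

lemma Matrix.PosSemidef.fromBlocks_diag {m n : Type*} [Fintype m] [Fintype n] [DecidableEq m]
    [DecidableEq n] {A : Matrix m m ℝ} {D : Matrix n n ℝ} (hA : A.PosSemidef)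
    (hD : D.PosSemidef) : (fromBlocks A 0 0 D).PosSemidef := by
  obtain ⟨R, hR, rfl, -⟩ := hA.exists_sqrt
  obtain ⟨T, hT, rfl, -⟩ := hD.exists_sqrt
  convert posSemidef_self_mul_conjTranspose (fromBlocks R 0 0 T) using 1
  rw [fromBlocks_conjTranspose, fromBlocks_multiply, hR.1.eq, hT.1.eq]
  simp

section Bipartite

variable {α β : Type*} [Fintype α] [Fintype β] [DecidableEq α] [DecidableEq β]
  {Ωα : Matrix α α ℝ} {Ωβ : Matrix β β ℝ}

/-- The mutual information of an optimal pure state below `σ` is at most that of `σ`. -/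
lemma RealUncertainty.exists_pure_det_le (hα : IsSympForm Ωα) (hβ : IsSympForm Ωβ)
    {σ : Matrix (α ⊕ β) (α ⊕ β) ℝ} (h : RealUncertainty (fromBlocks Ωα 0 0 Ωβ) σ) :
    ∃ τ, IsPureQCM (fromBlocks Ωα 0 0 Ωβ) τ ∧ (σ - τ).PosSemidef ∧
      τ.toBlocks₁₁.det * τ.toBlocks₂₂.det * σ.det ≤ σ.toBlocks₁₁.det * σ.toBlocks₂₂.det := by
  have hΩ := hα.fromBlocks hβ
  obtain ⟨τ, hτ, hle, hb⟩ := h.exists_pure_le hΩ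
  refine ⟨τ, hτ, hle, ?_⟩
  have hσ := h.posDef hΩ
  have hτ' := hτ.posDef hΩ
  have h1 : τ.toBlocks₁₁.det ^ 2 * σ.det ≤ σ.toBlocks₁₁.det * σ.toBlocks₂₂.det :=
    det_submatrix_sq_mul_det_le hΩ hσ hτ' hb (Equiv.refl _) (submatrix_id_id _)
  have h2 : τ.toBlocks₂₂.det ^ 2 * σ.det ≤ σ.toBlocks₂₂.det * σ.toBlocks₁₁.det :=
    det_submatrix_sq_mul_det_le hΩ hσ hτ' hb (Equiv.sumComm β α)
      (fromBlocks_submatrix_sum_swap_sum_swap _ _ _ _)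
  have hs := hσ.det_pos
  nlinarith [mul_nonneg (sq_nonneg (τ.toBlocks₁₁.det - τ.toBlocks₂₂.det)) hs.le]

lemma IsPureQCM.IM2_eq (hα : IsSympForm Ωα) (hβ : IsSympForm Ωβ)
    {γ : Matrix (α ⊕ β) (α ⊕ β) ℝ} (h : IsPureQCM (Matrix.fromBlocks Ωα 0 0 Ωβ) γ) :
    IM2 γ = 1 / 2 * Real.log (γ.toBlocks₁₁.det * γ.toBlocks₂₂.det) := by
  rw [IM2, h.det_eq_one (hα.fromBlocks hβ), div_one]

lemma Matrix.PosDef.det_toBlocks_mul_pos {γ : Matrix (α ⊕ β) (α ⊕ β) ℝ} (h : γ.PosDef) :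
    0 < γ.toBlocks₁₁.det * γ.toBlocks₂₂.det :=
  mul_pos (h.submatrix Sum.inl_injective).det_pos (h.submatrix Sum.inr_injective).det_pos

lemma IM2_nonneg {γ : Matrix (α ⊕ β) (α ⊕ β) ℝ} (h : γ.PosDef) : 0 ≤ IM2 γ := by
  refine mul_nonneg (by norm_num) (Real.log_nonneg ?_)
  rw [one_le_div h.det_pos]
  exact h.fischer

lemma bddBelow_EF2 {Ω : Matrix (α ⊕ β) (α ⊕ β) ℝ} (hΩ : IsSympForm Ω)
    (V : Matrix (α ⊕ β) (α ⊕ β) ℝ) :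
    BddBelow {x | ∃ γ : Matrix (α ⊕ β) (α ⊕ β) ℝ,
      IsPureQCM Ω γ ∧ (V - γ).PosSemidef ∧ x = (1 / 2) * IM2 γ} := by
  refine ⟨0, ?_⟩
  rintro x ⟨γ, hγ, -, rfl⟩
  exact mul_nonneg (by norm_num) (IM2_nonneg (hγ.posDef hΩ))

lemma RealUncertainty.nonempty_EF2 {Ω V : Matrix (α ⊕ β) (α ⊕ β) ℝ} (hΩ : IsSympForm Ω)
    (h : RealUncertainty Ω V) :
    {x | ∃ γ : Matrix (α ⊕ β) (α ⊕ β) ℝ,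
      IsPureQCM Ω γ ∧ (V - γ).PosSemidef ∧ x = (1 / 2) * IM2 γ}.Nonempty := by
  obtain ⟨τ, hτ, hle, -⟩ := h.exists_pure_le hΩ
  exact ⟨_, τ, hτ, hle, rfl⟩

end Bipartite

section FourPartite

variable {a₁ a₂ b₁ b₂ : Type*} [Fintype a₁] [Fintype a₂] [Fintype b₁] [Fintype b₂]
  [DecidableEq a₁] [DecidableEq a₂] [DecidableEq b₁] [DecidableEq b₂]
  {Ωa₁ : Matrix a₁ a₁ ℝ} {Ωa₂ : Matrix a₂ a₂ ℝ} {Ωb₁ : Matrix b₁ b₁ ℝ} {Ωb₂ : Matrix b₂ b₂ ℝ}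
  {γ : Matrix ((a₁ ⊕ a₂) ⊕ (b₁ ⊕ b₂)) ((a₁ ⊕ a₂) ⊕ (b₁ ⊕ b₂)) ℝ}

lemma IsPureQCM.det_mul_det_le (ha₁ : IsSympForm Ωa₁) (ha₂ : IsSympForm Ωa₂)
    (hb₁ : IsSympForm Ωb₁) (hb₂ : IsSympForm Ωb₂)
    (h : IsPureQCM (Matrix.fromBlocks (Matrix.fromBlocks Ωa₁ 0 0 Ωa₂) 0 0
      (Matrix.fromBlocks Ωb₁ 0 0 Ωb₂)) γ) :
    γ.toBlocks₂₂.toBlocks₂₂.det * γ.toBlocks₁₁.toBlocks₁₁.det ≤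
      γ.toBlocks₁₁.det * (γ.submatrix (Sum.map Sum.inl Sum.inl) (Sum.map Sum.inl Sum.inl)).det := by
  have hΩ := (ha₁.fromBlocks ha₂).fromBlocks (hb₁.fromBlocks hb₂)
  have hγ := h.posDef hΩ
  let e : (a₁ ⊕ (a₂ ⊕ b₁)) ⊕ b₂ ≃ (a₁ ⊕ a₂) ⊕ (b₁ ⊕ b₂) :=
    ((Equiv.sumAssoc a₁ a₂ b₁).symm.sumCongr (Equiv.refl b₂)).trans (Equiv.sumAssoc _ _ _)
  have hcompl := h.det_submatrix_eq hΩ e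
    (Ωx := Matrix.fromBlocks Ωa₁ 0 0 (Matrix.fromBlocks Ωa₂ 0 0 Ωb₁)) (Ωy := Ωb₂)
    (by ext ((i | i | i) | i) ((j | j | j) | j) <;> rfl)
  have hssa := (hγ.submatrix (e.injective.comp Sum.inl_injective)).det_strong_subadditivity
  rw [hcompl] at hssa
  have e₁ : γ.toBlocks₁₁ = (γ.submatrix (e ∘ Sum.inl) (e ∘ Sum.inl)).submatrix
      (Sum.map id Sum.inl) (Sum.map id Sum.inl) := by
    ext (i | i) (j | j) <;> rfl
  have e₂ : γ.submatrix (Sum.map Sum.inl Sum.inl) (Sum.map Sum.inl Sum.inl)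
      = (γ.submatrix (e ∘ Sum.inl) (e ∘ Sum.inl)).submatrix
        (Sum.map id Sum.inr) (Sum.map id Sum.inr) := by
    ext (i | i) (j | j) <;> rfl
  rw [e₁, e₂]
  exact hssa

/-- Superadditivity of the mutual information of a pure state, in determinant form. -/
lemma IsPureQCM.det_prod_le (ha₁ : IsSympForm Ωa₁) (ha₂ : IsSympForm Ωa₂)
    (hb₁ : IsSympForm Ωb₁) (hb₂ : IsSympForm Ωb₂)
    (h : IsPureQCM (Matrix.fromBlocks (Matrix.fromBlocks Ωa₁ 0 0 Ωa₂) 0 0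
      (Matrix.fromBlocks Ωb₁ 0 0 Ωb₂)) γ) :
    (γ.toBlocks₁₁.toBlocks₁₁.det * γ.toBlocks₂₂.toBlocks₁₁.det) *
      (γ.toBlocks₁₁.toBlocks₂₂.det * γ.toBlocks₂₂.toBlocks₂₂.det) ≤
      (γ.toBlocks₁₁.det * γ.toBlocks₂₂.det) *
        ((γ.submatrix (Sum.map Sum.inl Sum.inl) (Sum.map Sum.inl Sum.inl)).det *
          (γ.submatrix (Sum.map Sum.inr Sum.inr) (Sum.map Sum.inr Sum.inr)).det) := by
  have hΩ := (ha₁.fromBlocks ha₂).fromBlocks (hb₁.fromBlocks hb₂)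
  have hγ := h.posDef hΩ
  have h1 := h.det_mul_det_le ha₁ ha₂ hb₁ hb₂
  have h2 : γ.toBlocks₁₁.toBlocks₂₂.det * γ.toBlocks₂₂.toBlocks₁₁.det ≤ γ.toBlocks₂₂.det *
      (γ.submatrix (Sum.map Sum.inl Sum.inl) (Sum.map Sum.inl Sum.inl)).det := by
    have hs := h.submatrix (Equiv.sumComm (b₁ ⊕ b₂) (a₁ ⊕ a₂))
    rw [Equiv.sumComm_apply, fromBlocks_submatrix_sum_swap_sum_swap] at hs
    have h3 := hs.det_mul_det_le hb₁ hb₂ ha₁ ha₂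
    have e : (γ.submatrix (Sum.map Sum.inl Sum.inl) (Sum.map Sum.inl Sum.inl)).submatrix
        (Equiv.sumComm b₁ a₁) (Equiv.sumComm b₁ a₁) = (γ.submatrix Sum.swap Sum.swap).submatrix
          (Sum.map Sum.inl Sum.inl) (Sum.map Sum.inl Sum.inl) := by
      ext (i | i) (j | j) <;> rfl
    rw [← det_submatrix_equiv_self (Equiv.sumComm b₁ a₁)
      (γ.submatrix (Sum.map Sum.inl Sum.inl) (Sum.map Sum.inl Sum.inl)), e]
    exact h3
  have hcompl : (γ.submatrix (Sum.map Sum.inl Sum.inl) (Sum.map Sum.inl Sum.inl)).det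
      = (γ.submatrix (Sum.map Sum.inr Sum.inr) (Sum.map Sum.inr Sum.inr)).det := by
    have h4 := h.det_submatrix_eq hΩ (Equiv.sumSumSumComm a₁ a₂ b₁ b₂).symm
      (Ωx := Matrix.fromBlocks Ωa₁ 0 0 Ωb₁) (Ωy := Matrix.fromBlocks Ωa₂ 0 0 Ωb₂)
      (by ext ((i | i) | (i | i)) ((j | j) | (j | j)) <;> rfl)
    convert h4 using 2
    · ext (i | i) (j | j) <;> rfl
    · ext (i | i) (j | j) <;> rfl
  rw [← hcompl]
  have p1 : 0 < γ.toBlocks₁₁.toBlocks₁₁.det :=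
    (hγ.submatrix (Sum.inl_injective.comp Sum.inl_injective)).det_pos
  have p2 : 0 < γ.toBlocks₂₂.toBlocks₂₂.det :=
    (hγ.submatrix (Sum.inr_injective.comp Sum.inr_injective)).det_pos
  have p3 : 0 < γ.toBlocks₁₁.toBlocks₂₂.det :=
    (hγ.submatrix (Sum.inl_injective.comp Sum.inr_injective)).det_pos
  have p4 : 0 < γ.toBlocks₂₂.toBlocks₁₁.det :=
    (hγ.submatrix (Sum.inr_injective.comp Sum.inl_injective)).det_pos
  have := mul_le_mul h1 h2 (mul_pos p3 p4).le ((mul_pos p2 p1).le.trans h1)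
  refine le_trans (le_of_eq (by ring)) (this.trans (le_of_eq (by ring)))

/-- A pure state on `A₁A₂ : B₁B₂` dominates in mutual information a pair of pure states lying below
its reductions to `A₁ : B₁` and `A₂ : B₂`. -/
lemma IsPureQCM.exists_pure_reductions (ha₁ : IsSympForm Ωa₁) (ha₂ : IsSympForm Ωa₂)
    (hb₁ : IsSympForm Ωb₁) (hb₂ : IsSympForm Ωb₂)
    (h : IsPureQCM (Matrix.fromBlocks (Matrix.fromBlocks Ωa₁ 0 0 Ωa₂) 0 0
      (Matrix.fromBlocks Ωb₁ 0 0 Ωb₂)) γ) :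
    ∃ τ₁ τ₂, IsPureQCM (Matrix.fromBlocks Ωa₁ 0 0 Ωb₁) τ₁ ∧
      IsPureQCM (Matrix.fromBlocks Ωa₂ 0 0 Ωb₂) τ₂ ∧
      (γ.submatrix (Sum.map Sum.inl Sum.inl) (Sum.map Sum.inl Sum.inl) - τ₁).PosSemidef ∧
      (γ.submatrix (Sum.map Sum.inr Sum.inr) (Sum.map Sum.inr Sum.inr) - τ₂).PosSemidef ∧
      IM2 τ₁ + IM2 τ₂ ≤ IM2 γ := by
  have hΩ := (ha₁.fromBlocks ha₂).fromBlocks (hb₁.fromBlocks hb₂)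
  have hγ := h.posDef hΩ
  have hR := h.realUncertainty hΩ
  have hR₁ : RealUncertainty (Matrix.fromBlocks Ωa₁ 0 0 Ωb₁)
      (γ.submatrix (Sum.map Sum.inl Sum.inl) (Sum.map Sum.inl Sum.inl)) := by
    convert hR.submatrix (Sum.map Sum.inl Sum.inl) using 1
    ext (i | i) (j | j) <;> rfl
  have hR₂ : RealUncertainty (Matrix.fromBlocks Ωa₂ 0 0 Ωb₂)
      (γ.submatrix (Sum.map Sum.inr Sum.inr) (Sum.map Sum.inr Sum.inr)) := by
    convert hR.submatrix (Sum.map Sum.inr Sum.inr) using 1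
    ext (i | i) (j | j) <;> rfl
  obtain ⟨τ₁, hτ₁, hle₁, hd₁⟩ := hR₁.exists_pure_det_le ha₁ hb₁
  obtain ⟨τ₂, hτ₂, hle₂, hd₂⟩ := hR₂.exists_pure_det_le ha₂ hb₂
  refine ⟨τ₁, τ₂, hτ₁, hτ₂, hle₁, hle₂, ?_⟩
  have hs₁ := (hR₁.posDef (ha₁.fromBlocks hb₁)).det_pos
  have hs₂ := (hR₂.posDef (ha₂.fromBlocks hb₂)).det_pos
  have q₁ := (hτ₁.posDef (ha₁.fromBlocks hb₁)).det_toBlocks_mul_pos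
  have q₂ := (hτ₂.posDef (ha₂.fromBlocks hb₂)).det_toBlocks_mul_pos
  have hprod := h.det_prod_le ha₁ ha₂ hb₁ hb₂
  have hmul := mul_le_mul hd₁ hd₂ (mul_pos q₂ hs₂).le ((mul_pos q₁ hs₁).le.trans hd₁)
  have hfin := hmul.trans hprod
  rw [mul_mul_mul_comm] at hfin
  have hfin' := le_of_mul_le_mul_right hfin (mul_pos hs₁ hs₂)
  rw [h.IM2_eq (ha₁.fromBlocks ha₂) (hb₁.fromBlocks hb₂), hτ₁.IM2_eq ha₁ hb₁,
    hτ₂.IM2_eq ha₂ hb₂, ← mul_add, ← Real.log_mul q₁.ne' q₂.ne']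
  exact mul_le_mul_of_nonneg_left (Real.log_le_log (mul_pos q₁ q₂) hfin') (by norm_num)

lemma IM2_submatrix_sumSumSumComm {γ₁ : Matrix (a₁ ⊕ b₁) (a₁ ⊕ b₁) ℝ}
    {γ₂ : Matrix (a₂ ⊕ b₂) (a₂ ⊕ b₂) ℝ} (h₁ : γ₁.PosDef) (h₂ : γ₂.PosDef) :
    IM2 ((fromBlocks γ₁ 0 0 γ₂).submatrix (Equiv.sumSumSumComm a₁ a₂ b₁ b₂)
      (Equiv.sumSumSumComm a₁ a₂ b₁ b₂)) = IM2 γ₁ + IM2 γ₂ := by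
  have e₁ : ((fromBlocks γ₁ 0 0 γ₂).submatrix (Equiv.sumSumSumComm a₁ a₂ b₁ b₂)
      (Equiv.sumSumSumComm a₁ a₂ b₁ b₂)).toBlocks₁₁
      = fromBlocks γ₁.toBlocks₁₁ 0 0 γ₂.toBlocks₁₁ := by
    ext (i | i) (j | j) <;> rfl
  have e₂ : ((fromBlocks γ₁ 0 0 γ₂).submatrix (Equiv.sumSumSumComm a₁ a₂ b₁ b₂)
      (Equiv.sumSumSumComm a₁ a₂ b₁ b₂)).toBlocks₂₂
      = fromBlocks γ₁.toBlocks₂₂ 0 0 γ₂.toBlocks₂₂ := by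
    ext (i | i) (j | j) <;> rfl
  rw [IM2, IM2, IM2, e₁, e₂, det_submatrix_equiv_self, det_fromBlocks_zero₁₂,
    det_fromBlocks_zero₁₂, det_fromBlocks_zero₁₂, ← mul_add, ← Real.log_mul (div_pos h₁.det_toBlocks_mul_pos h₁.det_pos).ne'
      (div_pos h₂.det_toBlocks_mul_pos h₂.det_pos).ne']
  congr 2
  rw [div_mul_div_comm]
  ring

/-- Additivity of the Gaussian Rényi-2 entanglement of formation for general symplectic forms. -/
lemma EF2_submatrix_sumSumSumComm (ha₁ : IsSympForm Ωa₁) (ha₂ : IsSympForm Ωa₂)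
    (hb₁ : IsSympForm Ωb₁) (hb₂ : IsSympForm Ωb₂)
    {V : Matrix (a₁ ⊕ b₁) (a₁ ⊕ b₁) ℝ} {W : Matrix (a₂ ⊕ b₂) (a₂ ⊕ b₂) ℝ}
    (hV : RealUncertainty (fromBlocks Ωa₁ 0 0 Ωb₁) V)
    (hW : RealUncertainty (fromBlocks Ωa₂ 0 0 Ωb₂) W) :
    EF2 (fromBlocks (fromBlocks Ωa₁ 0 0 Ωa₂) 0 0 (fromBlocks Ωb₁ 0 0 Ωb₂))
      ((fromBlocks V 0 0 W).submatrix (Equiv.sumSumSumComm a₁ a₂ b₁ b₂)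
        (Equiv.sumSumSumComm a₁ a₂ b₁ b₂)) =
      EF2 (fromBlocks Ωa₁ 0 0 Ωb₁) V + EF2 (fromBlocks Ωa₂ 0 0 Ωb₂) W := by
  have hΩ₁ := ha₁.fromBlocks hb₁
  have hΩ₂ := ha₂.fromBlocks hb₂
  have hΩ := (ha₁.fromBlocks ha₂).fromBlocks (hb₁.fromBlocks hb₂)
  have hΩe : fromBlocks (fromBlocks Ωa₁ 0 0 Ωa₂) 0 0 (fromBlocks Ωb₁ 0 0 Ωb₂)
      = (fromBlocks (fromBlocks Ωa₁ 0 0 Ωb₁) 0 0 (fromBlocks Ωa₂ 0 0 Ωb₂)).submatrix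
        (Equiv.sumSumSumComm a₁ a₂ b₁ b₂) (Equiv.sumSumSumComm a₁ a₂ b₁ b₂) := by
    ext ((i | i) | (i | i)) ((j | j) | (j | j)) <;> rfl
  have hmem : ∀ γ₁ γ₂, IsPureQCM (fromBlocks Ωa₁ 0 0 Ωb₁) γ₁ → (V - γ₁).PosSemidef →
      IsPureQCM (fromBlocks Ωa₂ 0 0 Ωb₂) γ₂ → (W - γ₂).PosSemidef →
      1 / 2 * IM2 γ₁ + 1 / 2 * IM2 γ₂ ∈ {x | ∃ γ, IsPureQCM (fromBlocks
          (fromBlocks Ωa₁ 0 0 Ωa₂) 0 0 (fromBlocks Ωb₁ 0 0 Ωb₂)) γ ∧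
        ((fromBlocks V 0 0 W).submatrix (Equiv.sumSumSumComm a₁ a₂ b₁ b₂)
          (Equiv.sumSumSumComm a₁ a₂ b₁ b₂) - γ).PosSemidef ∧ x = 1 / 2 * IM2 γ} := by
    intro γ₁ γ₂ h₁ hle₁ h₂ hle₂
    refine ⟨(fromBlocks γ₁ 0 0 γ₂).submatrix
      (Equiv.sumSumSumComm a₁ a₂ b₁ b₂) (Equiv.sumSumSumComm a₁ a₂ b₁ b₂), ?_, ?_, ?_⟩
    · rw [hΩe]
      exact (h₁.fromBlocks h₂).submatrix _
    · convert (hle₁.fromBlocks_diag hle₂).submatrix (Equiv.sumSumSumComm a₁ a₂ b₁ b₂) using 1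
      ext ((i | i) | (i | i)) ((j | j) | (j | j)) <;> simp [Equiv.sumSumSumComm]
    · rw [IM2_submatrix_sumSumSumComm (h₁.posDef hΩ₁) (h₂.posDef hΩ₂), mul_add]
  apply le_antisymm
  · rw [← sub_le_iff_le_add]
    refine le_csInf (hV.nonempty_EF2 hΩ₁) ?_
    rintro _ ⟨γ₁, h₁, hle₁, rfl⟩
    rw [sub_le_comm]
    refine le_csInf (hW.nonempty_EF2 hΩ₂) ?_
    rintro _ ⟨γ₂, h₂, hle₂, rfl⟩
    rw [sub_le_iff_le_add']
    exact csInf_le (bddBelow_EF2 hΩ _) (hmem γ₁ γ₂ h₁ hle₁ h₂ hle₂)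
  · obtain ⟨_, γ₁, h₁, hle₁, -⟩ := hV.nonempty_EF2 hΩ₁
    obtain ⟨_, γ₂, h₂, hle₂, -⟩ := hW.nonempty_EF2 hΩ₂
    refine le_csInf ⟨_, hmem γ₁ γ₂ h₁ hle₁ h₂ hle₂⟩ ?_
    clear h₁ h₂ hle₁ hle₂ γ₁ γ₂
    rintro _ ⟨γ, h, hle, rfl⟩
    obtain ⟨τ₁, τ₂, h₁, h₂, hle₁, hle₂, hI⟩ := h.exists_pure_reductions ha₁ ha₂ hb₁ hb₂
    have hV₁ : (V - τ₁).PosSemidef := by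
      convert (hle.submatrix (Sum.map Sum.inl Sum.inl)).add hle₁ using 1
      ext (i | i) (j | j) <;> simp [Equiv.sumSumSumComm]
    have hW₂ : (W - τ₂).PosSemidef := by
      convert (hle.submatrix (Sum.map Sum.inr Sum.inr)).add hle₂ using 1
      ext (i | i) (j | j) <;> simp [Equiv.sumSumSumComm]
    have e₁ : EF2 (fromBlocks Ωa₁ 0 0 Ωb₁) V ≤ 1 / 2 * IM2 τ₁ :=
      csInf_le (bddBelow_EF2 hΩ₁ V) ⟨τ₁, h₁, hV₁, rfl⟩
    have e₂ : EF2 (fromBlocks Ωa₂ 0 0 Ωb₂) W ≤ 1 / 2 * IM2 τ₂ :=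
      csInf_le (bddBelow_EF2 hΩ₂ W) ⟨τ₂, h₂, hW₂, rfl⟩
    linarith

end FourPartite

/-- additivity: if `U` is the direct sum of the bipartite QCMs `V` (on
`A1 B1`) and `W` (on `A2 B2`), then, with respect to the bipartition `A1A2 : B1B2`,
`E^G_{F,2}(U) = E^G_{F,2}(V) + E^G_{F,2}(W)`. -/
theorem stmt19 {nA1 nB1 nA2 nB2 : ℕ}
    (V : Matrix ((Fin nA1 ⊕ Fin nA1) ⊕ (Fin nB1 ⊕ Fin nB1))
      ((Fin nA1 ⊕ Fin nA1) ⊕ (Fin nB1 ⊕ Fin nB1)) ℝ)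
    (W : Matrix ((Fin nA2 ⊕ Fin nA2) ⊕ (Fin nB2 ⊕ Fin nB2))
      ((Fin nA2 ⊕ Fin nA2) ⊕ (Fin nB2 ⊕ Fin nB2)) ℝ)
    (hV : IsQCM (fromBlocks (Omg nA1) 0 0 (Omg nB1)) V)
    (hW : IsQCM (fromBlocks (Omg nA2) 0 0 (Omg nB2)) W)
    (U : Matrix (((Fin nA1 ⊕ Fin nA1) ⊕ (Fin nA2 ⊕ Fin nA2)) ⊕
        ((Fin nB1 ⊕ Fin nB1) ⊕ (Fin nB2 ⊕ Fin nB2)))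
      (((Fin nA1 ⊕ Fin nA1) ⊕ (Fin nA2 ⊕ Fin nA2)) ⊕
        ((Fin nB1 ⊕ Fin nB1) ⊕ (Fin nB2 ⊕ Fin nB2))) ℝ)
    (hU : U = fromBlocks
      (fromBlocks V.toBlocks₁₁ 0 0 W.toBlocks₁₁)
      (fromBlocks V.toBlocks₁₂ 0 0 W.toBlocks₁₂)
      (fromBlocks V.toBlocks₂₁ 0 0 W.toBlocks₂₁)
      (fromBlocks V.toBlocks₂₂ 0 0 W.toBlocks₂₂)) :
    EF2 (fromBlocks (fromBlocks (Omg nA1) 0 0 (Omg nA2)) 0 0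
        (fromBlocks (Omg nB1) 0 0 (Omg nB2))) U =
      EF2 (fromBlocks (Omg nA1) 0 0 (Omg nB1)) V +
        EF2 (fromBlocks (Omg nA2) 0 0 (Omg nB2)) W := by
  convert EF2_submatrix_sumSumSumComm (isSympForm_Omg nA1) (isSympForm_Omg nA2)
    (isSympForm_Omg nB1) (isSympForm_Omg nB2) hV.realUncertainty hW.realUncertainty using 2
  rw [hU]
  ext ((i | i) | (i | i)) ((j | j) | (j | j)) <;> rfl
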